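/- (Achievability of the Gaussian channel capacity via the maximum-correlation decoder; Theorem 2 of the full paper.) Let P > 0, N > 0, δ ∈ (0, (1/2)·log(1+P/N)), and ε > 0. Then there exists n₀ such that for all n ≥ n₀ the following holds with M = ⌈exp( n·( (1/2)·log(1+P/N) − δ ) )⌉: let C₁,…,C_M be independent random vectors in ℝ^n, each with i.i.d. Gaussian N(0,P) coordinates, let Z ∈ ℝ^n have i.i.d. Gaussian N(0,N) coordinates independent of (C₁,…,C_M), and let Y = C₁ + Z. Then the maximum-empirical-correlation decoder fails with probability at most ε: Pr( ∃ i ∈ {2,…,M} : |ρ̂(C_i, Y)| ≥ |ρ̂(C₁, Y)| ) ≤ ε. -/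

import Mathlib

open MeasureTheory ProbabilityTheory

/-- Empirical correlation factor `ρ̂(x,y) = ⟨x,y⟩/(‖x‖·‖y‖)`, with the convention
`ρ̂(x,y) = 0` when `x = 0` or `y = 0`. -/
noncomputable def rhoHat {n : ℕ} (x y : Fin n → ℝ) : ℝ :=
  if x = 0 ∨ y = 0 then 0
  else (∑ i, x i * y i) / (Real.sqrt (∑ i, x i ^ 2) * Real.sqrt (∑ i, y i ^ 2))

open scoped NNReal ENNReal

/-- Gaussian integral of the exponential of a quadratic polynomial. -/
lemma lintegral_exp_quadratic_gaussianReal {v : ℝ≥0} (hv : v ≠ 0) (α β : ℝ)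
    (h : 0 < 1 + 2 * β * v) :
    ∫⁻ x, ENNReal.ofReal (Real.exp (α * x - β * x ^ 2)) ∂gaussianReal 0 v =
      ENNReal.ofReal ((Real.sqrt (1 + 2 * β * v))⁻¹ *
        Real.exp (v / (2 * (1 + 2 * β * v)) * α ^ 2)) := by
  have hv' : (0 : ℝ) < v := by positivity
  set s : ℝ := 1 + 2 * β * v with hs
  set w : ℝ≥0 := v / s.toNNReal with hw
  have hwr : (w : ℝ) = v / s := by simp [hw, h.le]
  have hw0 : w ≠ 0 := by
    have : (0 : ℝ) < w := by rw [hwr]; positivity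
    exact_mod_cast this.ne'
  have key (x : ℝ) : gaussianPDFReal 0 v x * Real.exp (α * x - β * x ^ 2) =
      ((Real.sqrt s)⁻¹ * Real.exp (v / (2 * s) * α ^ 2)) *
        gaussianPDFReal (α * (v / s)) w x := by
    rw [gaussianPDFReal_def, gaussianPDFReal_def]
    simp only [hwr]
    have h1 : Real.sqrt (2 * Real.pi * (v / s)) = Real.sqrt (2 * Real.pi * v) / Real.sqrt s := by
      rw [← Real.sqrt_div (by positivity), mul_div_assoc]
    have h2 : Real.exp (-(x - 0) ^ 2 / (2 * v)) * Real.exp (α * x - β * x ^ 2) =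
        Real.exp (v / (2 * s) * α ^ 2) *
          Real.exp (-(x - α * (v / s)) ^ 2 / (2 * (v / s))) := by
      rw [← Real.exp_add, ← Real.exp_add]
      congr 1
      field_simp
      rw [hs]
      ring
    have h3 : (Real.sqrt s) ≠ 0 := by positivity
    rw [h1, mul_assoc, h2]
    field_simp
  rw [gaussianReal_of_var_ne_zero _ hv,
    lintegral_withDensity_eq_lintegral_mul _ (measurable_gaussianPDF _ _) (by fun_prop)]
  have (x : ℝ) : (gaussianPDF 0 v * fun x ↦ ENNReal.ofReal (Real.exp (α * x - β * x ^ 2))) x =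
      ENNReal.ofReal ((Real.sqrt s)⁻¹ * Real.exp (v / (2 * s) * α ^ 2)) *
        gaussianPDF (α * (v / s)) w x := by
    rw [Pi.mul_apply, gaussianPDF, gaussianPDF,
      ← ENNReal.ofReal_mul (gaussianPDFReal_nonneg _ _ _), key,
      ENNReal.ofReal_mul (by positivity)]
  simp_rw [this]
  rw [lintegral_const_mul _ (measurable_gaussianPDF _ _), lintegral_gaussianPDF_eq_one _ hw0,
    mul_one]

/-- Gaussian integral of the exponential of a diagonal quadratic polynomial on `ℝⁿ`. -/
lemma lintegral_exp_quadratic_pi_gaussianReal {n : ℕ} {v : ℝ≥0} (hv : v ≠ 0) (α : Fin n → ℝ)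
    (β : ℝ) (h : 0 < 1 + 2 * β * v) :
    ∫⁻ x, ENNReal.ofReal (Real.exp (∑ i, (α i * x i - β * x i ^ 2)))
        ∂(Measure.pi fun _ : Fin n => gaussianReal 0 v) =
      ENNReal.ofReal ((Real.sqrt (1 + 2 * β * v))⁻¹ ^ n *
        Real.exp (v / (2 * (1 + 2 * β * v)) * ∑ i, α i ^ 2)) := by
  let X : Fin n → ℝ → ℝ≥0∞ := fun i x => ENNReal.ofReal (Real.exp (α i * x - β * x ^ 2))
  have hX (i) : Measurable (X i) := by fun_prop
  have hind := iIndepFun_pi (μ := fun _ : Fin n => gaussianReal 0 v) (X := X)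
    fun i => (hX i).aemeasurable
  have hprod := lintegral_prod_eq_prod_lintegral_of_indepFun Finset.univ
    (fun i (x : Fin n → ℝ) => X i (x i)) hind fun i => (hX i).comp (measurable_pi_apply i)
  have h1 (x : Fin n → ℝ) : ENNReal.ofReal (Real.exp (∑ i, (α i * x i - β * x i ^ 2))) =
      ∏ i, X i (x i) := by
    rw [Real.exp_sum, ENNReal.ofReal_prod_of_nonneg fun i _ => (Real.exp_pos _).le]
  have h2 (i : Fin n) : ∫⁻ x, X i (x i) ∂(Measure.pi fun _ : Fin n => gaussianReal 0 v) =
      ENNReal.ofReal ((Real.sqrt (1 + 2 * β * v))⁻¹ *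
        Real.exp (v / (2 * (1 + 2 * β * v)) * α i ^ 2)) := by
    rw [← lintegral_exp_quadratic_gaussianReal hv _ _ h]
    exact (measurePreserving_eval (fun _ : Fin n => gaussianReal 0 v) i).lintegral_comp (hX i)
  simp_rw [h1, hprod, h2]
  rw [← ENNReal.ofReal_prod_of_nonneg fun i _ => by positivity, Finset.prod_mul_distrib,
    ← Real.exp_sum, Finset.mul_sum]
  simp

/-- Gaussian integral of the exponential of a bivariate quadratic form in independent
Gaussian vectors. -/
lemma lintegral_exp_bivariate_quadratic {n : ℕ} {v w : ℝ≥0} (hv : v ≠ 0) (hw : w ≠ 0)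
    (a b c : ℝ) (h : 0 < 1 + 2 * a * v)
    (h' : 0 < 1 + 2 * (c - v / (2 * (1 + 2 * a * v)) * b ^ 2) * w) :
    ∫⁻ z, ∫⁻ x, ENNReal.ofReal
        (Real.exp (-∑ i, (a * x i ^ 2 + b * x i * z i + c * z i ^ 2)))
        ∂(Measure.pi fun _ : Fin n => gaussianReal 0 v)
        ∂(Measure.pi fun _ : Fin n => gaussianReal 0 w) =
      ENNReal.ofReal ((Real.sqrt ((1 + 2 * a * v) *
        (1 + 2 * (c - v / (2 * (1 + 2 * a * v)) * b ^ 2) * w)))⁻¹ ^ n) := by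
  set γ := c - v / (2 * (1 + 2 * a * v)) * b ^ 2 with hγ
  have h1 (z : Fin n → ℝ) : ∫⁻ x, ENNReal.ofReal
        (Real.exp (-∑ i, (a * x i ^ 2 + b * x i * z i + c * z i ^ 2)))
        ∂(Measure.pi fun _ : Fin n => gaussianReal 0 v) =
      ENNReal.ofReal ((Real.sqrt (1 + 2 * a * v))⁻¹ ^ n) *
        ENNReal.ofReal (Real.exp (∑ i, (0 * z i - γ * z i ^ 2))) := by
    have h2 (x : Fin n → ℝ) : ENNReal.ofReal
        (Real.exp (-∑ i, (a * x i ^ 2 + b * x i * z i + c * z i ^ 2))) =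
        ENNReal.ofReal (Real.exp (-c * ∑ i, z i ^ 2)) *
          ENNReal.ofReal (Real.exp (∑ i, ((-b * z i) * x i - a * x i ^ 2))) := by
      rw [← ENNReal.ofReal_mul (Real.exp_pos _).le, ← Real.exp_add, Finset.mul_sum,
        ← Finset.sum_neg_distrib, ← Finset.sum_add_distrib]
      congr 3 with i
      ring
    simp_rw [h2]
    rw [lintegral_const_mul _ (by fun_prop), lintegral_exp_quadratic_pi_gaussianReal hv _ _ h,
      ← ENNReal.ofReal_mul (by positivity), ← ENNReal.ofReal_mul (by positivity),
      mul_left_comm, ← Real.exp_add, Finset.mul_sum, Finset.mul_sum, ← Finset.sum_add_distrib]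
    congr 4 with i
    rw [hγ]
    ring
  simp_rw [h1]
  rw [lintegral_const_mul _ (by fun_prop),
    lintegral_exp_quadratic_pi_gaussianReal hw (fun _ => 0) _ h',
    ← ENNReal.ofReal_mul (by positivity), Real.sqrt_mul h.le]
  simp [mul_pow, mul_comm]

lemma measurable_rhoHat {n : ℕ} :
    Measurable fun p : (Fin n → ℝ) × (Fin n → ℝ) => rhoHat p.1 p.2 := by
  unfold rhoHat
  refine Measurable.ite ?_ measurable_const (by fun_prop)
  exact (measurable_fst (measurableSet_singleton 0)).union
    (measurable_snd (measurableSet_singleton 0))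

lemma sum_sq_pos_of_ne_zero {n : ℕ} {x : Fin n → ℝ} (hx : x ≠ 0) : 0 < ∑ i, x i ^ 2 := by
  obtain ⟨i, hi⟩ := Function.ne_iff.mp hx
  have : x i ≠ 0 := hi
  exact Finset.sum_pos' (fun i _ => sq_nonneg _) ⟨i, Finset.mem_univ i, by positivity⟩

/-- If the empirical correlation is at most `t`, then the inner product is at most `t` times
the bound for the product of the norms given by Young's inequality. -/
lemma inner_le_of_abs_rhoHat_le {n : ℕ} {x y : Fin n → ℝ} {t κ : ℝ} (ht : 0 ≤ t) (hκ : 0 < κ)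
    (h : |rhoHat x y| ≤ t) :
    ∑ i, x i * y i ≤ t / 2 * (κ * ∑ i, x i ^ 2 + κ⁻¹ * ∑ i, y i ^ 2) := by
  by_cases h0 : x = 0 ∨ y = 0
  · have : ∑ i, x i * y i = 0 := by rcases h0 with rfl | rfl <;> simp
    rw [this]
    positivity
  · rw [rhoHat, if_neg h0] at h
    rw [not_or] at h0
    have hx := sum_sq_pos_of_ne_zero h0.1
    have hy := sum_sq_pos_of_ne_zero h0.2
    have hu := Real.sq_sqrt hx.le
    have hw := Real.sq_sqrt hy.le
    have hu0 := Real.sqrt_pos.mpr hx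
    have hw0 := Real.sqrt_pos.mpr hy
    set u := Real.sqrt (∑ i, x i ^ 2)
    set w := Real.sqrt (∑ i, y i ^ 2)
    rw [← hu, ← hw]
    have h1 := (le_abs_self _).trans h
    rw [div_le_iff₀ (by positivity)] at h1
    have h2 : κ * u ^ 2 + κ⁻¹ * w ^ 2 - 2 * (u * w) = κ⁻¹ * (κ * u - w) ^ 2 := by
      field_simp
      ring
    have h3 : 0 ≤ κ⁻¹ * (κ * u - w) ^ 2 := by positivity
    nlinarith

/-- If the empirical correlation of `x` with `y` is at least `t > 0`, then so is that of `x`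
with the normalization of `y`. -/
lemma sq_le_of_le_abs_rhoHat {n : ℕ} {x y : Fin n → ℝ} {t : ℝ} (ht : 0 < t)
    (h : t ≤ |rhoHat x y|) :
    t ^ 2 * ∑ i, x i ^ 2 ≤ (∑ i, y i / Real.sqrt (∑ j, y j ^ 2) * x i) ^ 2 := by
  by_cases h0 : x = 0 ∨ y = 0
  · rw [rhoHat, if_pos h0, abs_zero] at h
    linarith
  · rw [rhoHat, if_neg h0] at h
    rw [not_or] at h0
    have hx := sum_sq_pos_of_ne_zero h0.1
    have hu := Real.sq_sqrt hx.le
    have hu0 := Real.sqrt_pos.mpr hx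
    have h1 : ∑ i, y i / Real.sqrt (∑ j, y j ^ 2) * x i =
        (∑ i, x i * y i) / Real.sqrt (∑ j, y j ^ 2) := by
      rw [Finset.sum_div]
      exact Finset.sum_congr rfl fun i _ => by ring
    set u := Real.sqrt (∑ i, x i ^ 2)
    rw [h1, ← hu, ← mul_pow, ← sq_abs (_ / _)]
    gcongr
    rw [mul_comm u, ← div_div, abs_div, abs_of_pos hu0] at h
    exact (le_div_iff₀ hu0).mp h

/-- Chernoff bound for the empirical correlation of a Gaussian vector with a fixed vector. -/
lemma measure_le_abs_rhoHat_le {n : ℕ} {v : ℝ≥0} (hv : v ≠ 0) {t b : ℝ} (ht : 0 < t)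
    (hb : 0 ≤ b) (hbt : b * (1 - t ^ 2) < 1) (y : Fin n → ℝ) :
    (Measure.pi fun _ : Fin n => gaussianReal 0 v) {x | t ≤ |rhoHat x y|} ≤
      ENNReal.ofReal ((Real.sqrt (1 - b / (1 + b * t ^ 2)))⁻¹ *
        (Real.sqrt (1 + b * t ^ 2))⁻¹ ^ n) := by
  by_cases hy : y = 0
  · have : {x : Fin n → ℝ | t ≤ |rhoHat x y|} = ∅ := by
      ext x
      simp [rhoHat, hy, ht]
    simp [this]
  have hv' : (0 : ℝ) < v := by positivity
  have hS := sum_sq_pos_of_ne_zero hy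
  set u : Fin n → ℝ := fun i => y i / Real.sqrt (∑ j, y j ^ 2) with hu
  have hu1 : ∑ i, u i ^ 2 = 1 := by
    simp only [hu, div_pow, Real.sq_sqrt hS.le]
    rw [← Finset.sum_div, div_self hS.ne']
  set s := Real.sqrt (b / v)
  have hs : s ^ 2 = b / v := Real.sq_sqrt (by positivity)
  set β : ℝ := b * t ^ 2 / (2 * v) with hβ
  have hβv : 1 + 2 * β * v = 1 + b * t ^ 2 := by rw [hβ]; field_simp
  have hpos : 0 < 1 + b * t ^ 2 := by positivity
  let F : (Fin n → ℝ) → ℝ → ℝ≥0∞ := fun x g =>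
    ENNReal.ofReal (Real.exp (∑ i, (s * g * u i * x i - β * x i ^ 2)))
  have hF : Measurable (Function.uncurry F) := by
    simp only [F, Function.uncurry_def]
    fun_prop
  have hFx (x : Fin n → ℝ) : ∫⁻ g, F x g ∂gaussianReal 0 1 =
      ENNReal.ofReal (Real.exp (1 / 2 * (s * ∑ i, u i * x i) ^ 2 - β * ∑ i, x i ^ 2)) := by
    have h1 (g : ℝ) : F x g = ENNReal.ofReal (Real.exp (-β * ∑ i, x i ^ 2)) *
        ENNReal.ofReal (Real.exp ((s * ∑ i, u i * x i) * g - 0 * g ^ 2)) := by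
      rw [← ENNReal.ofReal_mul (Real.exp_pos _).le, ← Real.exp_add]
      simp only [F, Finset.sum_sub_distrib, ← Finset.mul_sum, mul_assoc]
      congr 2
      ring
    simp_rw [h1]
    rw [lintegral_const_mul _ (by fun_prop),
      lintegral_exp_quadratic_gaussianReal one_ne_zero _ _ (by norm_num),
      ← ENNReal.ofReal_mul (Real.exp_pos _).le]
    simp only [mul_zero, add_zero, Real.sqrt_one, inv_one, one_mul, mul_one,
      NNReal.coe_one]
    rw [← Real.exp_add]
    congr 2
    ring
  have hlt : 0 < 1 - b / (1 + b * t ^ 2) := by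
    rw [sub_pos, div_lt_one hpos]
    linarith
  have hFg (g : ℝ) : ∫⁻ x, F x g ∂(Measure.pi fun _ : Fin n => gaussianReal 0 v) =
      ENNReal.ofReal ((Real.sqrt (1 + b * t ^ 2))⁻¹ ^ n) *
        ENNReal.ofReal (Real.exp (0 * g - (-(b / (2 * (1 + b * t ^ 2)))) * g ^ 2)) := by
    have := lintegral_exp_quadratic_pi_gaussianReal hv (fun i => s * g * u i) β
      (by rw [hβv]; exact hpos)
    rw [hβv] at this
    simp only [F]
    rw [this, ← ENNReal.ofReal_mul (by positivity)]
    simp only [mul_pow, ← Finset.mul_sum, hu1, hs]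
    congr 3
    field_simp
    ring
  calc (Measure.pi fun _ : Fin n => gaussianReal 0 v) {x | t ≤ |rhoHat x y|}
      ≤ ∫⁻ x, ∫⁻ g, F x g ∂gaussianReal 0 1 ∂(Measure.pi fun _ : Fin n => gaussianReal 0 v) := by
        refine meas_le_lintegral₀ (Measurable.lintegral_prod_right' hF).aemeasurable
          fun x hx => ?_
        simp only [Function.uncurry_apply_pair]
        rw [hFx, ← ENNReal.ofReal_one]
        refine ENNReal.ofReal_le_ofReal (Real.one_le_exp ?_)
        have h1 := sq_le_of_le_abs_rhoHat ht hx
        have h2 : 1 / 2 * (s * ∑ i, u i * x i) ^ 2 - β * ∑ i, x i ^ 2 =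
            b / (2 * v) * ((∑ i, u i * x i) ^ 2 - t ^ 2 * ∑ i, x i ^ 2) := by
          rw [mul_pow, hs, hβ]
          field_simp
        rw [h2]
        exact mul_nonneg (by positivity) (sub_nonneg.mpr h1)
    _ = ∫⁻ g, ∫⁻ x, F x g ∂(Measure.pi fun _ : Fin n => gaussianReal 0 v) ∂gaussianReal 0 1 :=
        lintegral_lintegral_swap hF.aemeasurable
    _ = _ := by
        have h1 : 1 + 2 * (-(b / (2 * (1 + b * t ^ 2)))) * ((1 : ℝ≥0) : ℝ) =
            1 - b / (1 + b * t ^ 2) := by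
          push_cast
          field_simp
          ring
        simp_rw [hFg]
        rw [lintegral_const_mul _ (by fun_prop),
          lintegral_exp_quadratic_gaussianReal one_ne_zero _ _ (by rw [h1]; exact hlt), h1,
          ← ENNReal.ofReal_mul (by positivity)]
        congr 1
        simp [mul_comm]

/-- The empirical correlation of the transmitted and received words is below any
`t < √(v / (v + w))` with exponentially small probability. -/
lemma exists_lintegral_measure_abs_rhoHat_le {v w : ℝ≥0} (hv : v ≠ 0) (hw : w ≠ 0) {t : ℝ}
    (ht : 0 ≤ t) (htv : t < Real.sqrt (v / (v + w))) :
    ∃ d : ℝ, 0 ≤ d ∧ d < 1 ∧ ∀ n : ℕ,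
      ∫⁻ z, (Measure.pi fun _ : Fin n => gaussianReal 0 v) {x | |rhoHat x (x + z)| ≤ t}
        ∂(Measure.pi fun _ : Fin n => gaussianReal 0 w) ≤ ENNReal.ofReal (d ^ n) := by
  have hv' : (0 : ℝ) < v := by positivity
  have hw' : (0 : ℝ) < w := by positivity
  set κ := (Real.sqrt (v / (v + w)))⁻¹ with hκ
  have hκ0 : 0 < κ := by positivity
  have hκ2 : κ ^ 2 = (v + w) / v := by
    rw [hκ, inv_pow, Real.sq_sqrt (by positivity), inv_div]
  have htκ : t * κ < 1 := by
    rw [hκ, ← div_eq_mul_inv, div_lt_one (by positivity)]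
    exact htv
  set a : ℝ := 1 - t / 2 * (κ + κ⁻¹) with ha
  set b : ℝ := 1 - t * κ⁻¹ with hb
  set c : ℝ := -(t / 2 * κ⁻¹) with hc
  have hm : 0 < a * v + c * w := by
    have h1 : a * v + c * w = v * (1 - t * κ) := by
      have : (w : ℝ) = κ ^ 2 * v - v := by rw [hκ2]; field_simp; ring
      rw [ha, hc, this]
      field_simp
      ring
    rw [h1]
    exact mul_pos hv' (by linarith)
  obtain ⟨θ, hθ, hA, hθd⟩ : ∃ θ : ℝ, 0 < θ ∧ 0 < 1 + 2 * (θ * a) * v ∧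
      0 < 2 * (a * v + c * w) + θ * (v * w * (4 * a * c - b ^ 2)) := by
    have h1 : ∀ᶠ θ : ℝ in nhds 0, 0 < 1 + 2 * (θ * a) * v :=
      (show Continuous fun θ : ℝ => 1 + 2 * (θ * a) * v by fun_prop).continuousAt.eventually
        (lt_mem_nhds (by simp))
    have h2 : ∀ᶠ θ : ℝ in nhds 0, 0 < 2 * (a * v + c * w) + θ * (v * w * (4 * a * c - b ^ 2)) :=
      (show Continuous fun θ : ℝ => 2 * (a * v + c * w) + θ * (v * w * (4 * a * c - b ^ 2)) by
        fun_prop).continuousAt.eventually (lt_mem_nhds (by simpa using hm))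
    obtain ⟨θ, h, hθ⟩ := (((h1.and h2).filter_mono nhdsWithin_le_nhds).and
      (self_mem_nhdsWithin (s := Set.Ioi (0 : ℝ)))).exists
    exact ⟨θ, hθ, h.1, h.2⟩
  set D : ℝ := (1 + 2 * (θ * a) * v) *
    (1 + 2 * (θ * c - v / (2 * (1 + 2 * (θ * a) * v)) * (θ * b) ^ 2) * w) with hD
  have hD1 : 1 < D := by
    have : D = 1 + θ * (2 * (a * v + c * w) + θ * (v * w * (4 * a * c - b ^ 2))) := by
      have h1 {A X : ℝ} (hA : A ≠ 0) : A * (1 + 2 * (θ * c - v / (2 * A) * X) * w) =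
          A * (1 + 2 * θ * c * w) - v * X * w := by
        field_simp
        ring
      rw [hD, h1 hA.ne']
      ring
    rw [this]
    have := mul_pos hθ hθd
    linarith
  have hB : 0 < 1 + 2 * (θ * c - v / (2 * (1 + 2 * (θ * a) * v)) * (θ * b) ^ 2) * w :=
    pos_of_mul_pos_right (zero_lt_one.trans hD1) hA.le
  refine ⟨(Real.sqrt D)⁻¹, by positivity,
    inv_lt_one_of_one_lt₀ (Real.lt_sqrt_of_sq_lt (by simpa using hD1)), fun n => ?_⟩
  rw [hD, ← lintegral_exp_bivariate_quadratic hv hw _ _ _ hA hB]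
  refine lintegral_mono fun z => meas_le_lintegral₀ (by fun_prop) fun x hx => ?_
  rw [← ENNReal.ofReal_one]
  refine ENNReal.ofReal_le_ofReal (Real.one_le_exp ?_)
  have h1 := inner_le_of_abs_rhoHat_le ht hκ0 hx
  have h2 : -∑ i, (θ * a * x i ^ 2 + θ * b * x i * z i + θ * c * z i ^ 2) =
      θ * (t / 2 * (κ * ∑ i, x i ^ 2 + κ⁻¹ * ∑ i, (x + z) i ^ 2) - ∑ i, x i * (x + z) i) := by
    simp only [Finset.mul_sum, ← Finset.sum_add_distrib, ← Finset.sum_sub_distrib,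
      ← Finset.sum_neg_distrib, Pi.add_apply]
    refine Finset.sum_congr rfl fun i _ => ?_
    rw [ha, hb, hc]
    ring
  rw [h2]
  exact mul_nonneg hθ.le (sub_nonneg.mpr h1)

/-- Choice of the correlation threshold `t` and of the Chernoff parameter `b`. -/
lemma exists_threshold_of_lt {ρ E : ℝ} (hρ : 0 < ρ) (hρ1 : ρ < 1) (hE : E < (1 - ρ ^ 2)⁻¹) :
    ∃ t b : ℝ, 0 < t ∧ t < ρ ∧ 0 ≤ b ∧ b * (1 - t ^ 2) < 1 ∧ E < 1 + b * t ^ 2 := by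
  have h0 : 0 < 1 - ρ ^ 2 := by nlinarith
  have h1 : ContinuousAt (fun r : ℝ => 1 + r / (1 - (r * ρ) ^ 2) * (r * ρ) ^ 2) 1 := by
    have : 1 - (1 * ρ) ^ 2 ≠ 0 := by rw [one_mul]; exact h0.ne'
    fun_prop (disch := assumption)
  have h2 : E < 1 + 1 / (1 - (1 * ρ) ^ 2) * (1 * ρ) ^ 2 := by
    convert hE using 1
    rw [one_mul]
    field_simp
    ring
  obtain ⟨r, hr, hr0, hr1⟩ := (((h1.eventually (lt_mem_nhds h2)).filter_mono
    nhdsWithin_le_nhds).and (Ioo_mem_nhdsLT zero_lt_one)).exists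
  have h3 : 0 < 1 - (r * ρ) ^ 2 := by
    have : r * ρ < 1 := by nlinarith
    have : 0 < r * ρ := by positivity
    nlinarith
  refine ⟨r * ρ, r / (1 - (r * ρ) ^ 2), by positivity, by nlinarith, by positivity, ?_, hr⟩
  rwa [div_mul_cancel₀ _ h3.ne']

/-- Chernoff bound for the empirical correlation of an independent codeword with the received
word. -/
lemma measure_le_abs_rhoHat_competitor_le {n M : ℕ} {v : ℝ≥0} (hv : v ≠ 0)
    (ν : Measure (Fin n → ℝ)) [IsProbabilityMeasure ν] {t b : ℝ} (ht : 0 < t)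
    (hb : 0 ≤ b) (hbt : b * (1 - t ^ 2) < 1) {i j : Fin M} (hij : i ≠ j) :
    ((Measure.pi fun _ : Fin M => Measure.pi fun _ : Fin n => gaussianReal 0 v).prod ν)
      {p | t ≤ |rhoHat (p.1 i) (p.1 j + p.2)|} ≤
      ENNReal.ofReal ((Real.sqrt (1 - b / (1 + b * t ^ 2)))⁻¹ *
        (Real.sqrt (1 + b * t ^ 2))⁻¹ ^ n) := by
  set μ := Measure.pi fun _ : Fin n => gaussianReal 0 v
  have hind : IndepFun (fun C : Fin M → Fin n → ℝ => C i) (fun C => C j)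
      (Measure.pi fun _ : Fin M => μ) :=
    (iIndepFun_pi (μ := fun _ : Fin M => μ) (X := fun _ x => x)
      fun _ => aemeasurable_id).indepFun hij
  have hmap := (indepFun_iff_map_prod_eq_prod_map_map
    (measurable_pi_apply i).aemeasurable (measurable_pi_apply j).aemeasurable).mp hind
  rw [(measurePreserving_eval (fun _ : Fin M => μ) i).map_eq,
    (measurePreserving_eval (fun _ : Fin M => μ) j).map_eq] at hmap
  have hmeas : MeasurableSet {p : (Fin M → Fin n → ℝ) × (Fin n → ℝ) |
      t ≤ |rhoHat (p.1 i) (p.1 j + p.2)|} := by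
    refine measurableSet_le measurable_const (Measurable.abs ?_)
    exact measurable_rhoHat.comp (f := fun p : (Fin M → Fin n → ℝ) × (Fin n → ℝ) =>
      (p.1 i, p.1 j + p.2)) (by fun_prop)
  rw [Measure.prod_apply_symm hmeas]
  refine (lintegral_mono (g := fun _ => _) fun z => ?_).trans_eq
    ((lintegral_const _).trans (by rw [measure_univ, mul_one]))
  have hmeas' : MeasurableSet {q : (Fin n → ℝ) × (Fin n → ℝ) | t ≤ |rhoHat q.1 (q.2 + z)|} := by
    refine measurableSet_le measurable_const (Measurable.abs ?_)
    exact measurable_rhoHat.comp (f := fun q : (Fin n → ℝ) × (Fin n → ℝ) =>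
      (q.1, q.2 + z)) (by fun_prop)
  calc (Measure.pi fun _ : Fin M => μ) {C | t ≤ |rhoHat (C i) (C j + z)|}
      = (μ.prod μ) {q | t ≤ |rhoHat q.1 (q.2 + z)|} := by
        rw [← hmap, Measure.map_apply (by fun_prop) hmeas']
        rfl
    _ = ∫⁻ x, μ {c | t ≤ |rhoHat c (x + z)|} ∂μ := Measure.prod_apply_symm hmeas'
    _ ≤ ∫⁻ _, ENNReal.ofReal ((Real.sqrt (1 - b / (1 + b * t ^ 2)))⁻¹ *
          (Real.sqrt (1 + b * t ^ 2))⁻¹ ^ n) ∂μ :=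
        lintegral_mono fun x => measure_le_abs_rhoHat_le hv ht hb hbt _
    _ = _ := by rw [lintegral_const, measure_univ, mul_one]

lemma measure_abs_rhoHat_transmitted {n M : ℕ} (μ ν : Measure (Fin n → ℝ))
    [IsProbabilityMeasure μ] [IsProbabilityMeasure ν] (t : ℝ) (j : Fin M) :
    ((Measure.pi fun _ : Fin M => μ).prod ν) {p | |rhoHat (p.1 j) (p.1 j + p.2)| ≤ t} =
      ∫⁻ z, μ {x | |rhoHat x (x + z)| ≤ t} ∂ν := by
  have hmeas : MeasurableSet {p : (Fin M → Fin n → ℝ) × (Fin n → ℝ) |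
      |rhoHat (p.1 j) (p.1 j + p.2)| ≤ t} := by
    refine measurableSet_le (Measurable.abs ?_) measurable_const
    exact measurable_rhoHat.comp (f := fun p : (Fin M → Fin n → ℝ) × (Fin n → ℝ) =>
      (p.1 j, p.1 j + p.2)) (by fun_prop)
  rw [Measure.prod_apply_symm hmeas]
  refine lintegral_congr fun z => ?_
  have hmeas' : MeasurableSet {x : Fin n → ℝ | |rhoHat x (x + z)| ≤ t} := by
    refine measurableSet_le (Measurable.abs ?_) measurable_const
    exact measurable_rhoHat.comp (f := fun x : Fin n → ℝ => (x, x + z)) (by fun_prop)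
  exact (measurePreserving_eval (fun _ : Fin M => μ) j).measure_preimage
    hmeas'.nullMeasurableSet

/-- Achievability of the Gaussian channel capacity via the maximum-correlation decoder
(Theorem 2 of the full paper): with `M = ⌈exp(n((1/2)log(1+P/N) − δ))⌉` i.i.d. Gaussian
codewords `C₁,…,C_M`, independent noise `Z`, and received word `Y = C₁ + Z`, the probability
that some competing codeword has empirical correlation with `Y` at least that of `C₁` is at
most `ε`, for all `n` large enough. -/
theorem gaussian_capacity_max_correlation_decoder (P N : ℝ) (hP : 0 < P) (hN : 0 < N)
    (δ : ℝ) (hδ : δ ∈ Set.Ioo 0 ((1 / 2) * Real.log (1 + P / N)))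
    (ε : ℝ) (hε : 0 < ε) :
    ∃ n₀ : ℕ, ∀ n, n₀ ≤ n →
      ∀ M : ℕ, M = ⌈Real.exp (n * ((1 / 2) * Real.log (1 + P / N) - δ))⌉₊ →
      ∀ i₁ : Fin M, (i₁ : ℕ) = 0 →
        ((Measure.pi fun _ : Fin M => Measure.pi fun _ : Fin n => gaussianReal 0 P.toNNReal).prod
            (Measure.pi fun _ : Fin n => gaussianReal 0 N.toNNReal))
            {p : (Fin M → Fin n → ℝ) × (Fin n → ℝ) |
              ∃ i : Fin M, i ≠ i₁ ∧
                |rhoHat (p.1 i₁) (p.1 i₁ + p.2)| ≤ |rhoHat (p.1 i) (p.1 i₁ + p.2)|}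
          ≤ ENNReal.ofReal ε := by
  obtain ⟨hδ0, hδ1⟩ := hδ
  set R := (1 / 2) * Real.log (1 + P / N) with hR
  have hv : P.toNNReal ≠ 0 := by simpa using hP
  have hw : N.toNNReal ≠ 0 := by simpa using hN
  set e := Real.exp (R - δ) with he
  have he1 : 1 < e := Real.one_lt_exp_iff.mpr (by linarith)
  set ρ := Real.sqrt (P / (P + N)) with hρ
  have hρ0 : 0 < ρ := by positivity
  have hρ2 : ρ ^ 2 = P / (P + N) := Real.sq_sqrt (by positivity)
  have hρ1 : ρ < 1 := by
    rw [hρ, Real.sqrt_lt' one_pos, one_pow, div_lt_one (by positivity)]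
    linarith
  have hE : e ^ 2 < (1 - ρ ^ 2)⁻¹ := by
    have h1 : (1 - ρ ^ 2)⁻¹ = Real.exp (2 * R) := by
      rw [hR, ← mul_assoc, mul_one_div_cancel two_ne_zero, one_mul,
        Real.exp_log (by positivity), hρ2, one_sub_div (by positivity),
        add_sub_cancel_left, inv_div, add_div, div_self hN.ne', add_comm]
    rw [h1, he, ← Real.exp_nat_mul, Real.exp_lt_exp]
    push_cast
    linarith
  obtain ⟨t, b, ht0, htρ, hb, hbt, hEb⟩ := exists_threshold_of_lt hρ0 hρ1 hE
  obtain ⟨d, hd0, hd1, hd⟩ := exists_lintegral_measure_abs_rhoHat_le hv hw ht0.le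
    (by rwa [Real.coe_toNNReal _ hP.le, Real.coe_toNNReal _ hN.le])
  set K := (Real.sqrt (1 - b / (1 + b * t ^ 2)))⁻¹
  set q := (Real.sqrt (1 + b * t ^ 2))⁻¹ with hq
  have hK0 : 0 ≤ K := by positivity
  have hq0 : 0 ≤ q := by positivity
  have heq : e * q < 1 := by
    rw [hq, ← div_eq_mul_inv, div_lt_one (by positivity)]
    exact Real.lt_sqrt_of_sq_lt hEb
  have hq1 : q < 1 := by nlinarith
  have hlim : Filter.Tendsto (fun n : ℕ => d ^ n + K * ((e * q) ^ n + q ^ n)) Filter.atTop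
      (nhds 0) := by
    have h1 := tendsto_pow_atTop_nhds_zero_of_lt_one hd0 hd1
    have h2 := tendsto_pow_atTop_nhds_zero_of_lt_one (by positivity) heq
    have h3 := tendsto_pow_atTop_nhds_zero_of_lt_one hq0 hq1
    simpa using h1.add ((h2.add h3).const_mul K)
  obtain ⟨n₀, hn₀⟩ := Filter.eventually_atTop.mp (hlim.eventually (gt_mem_nhds hε))
  refine ⟨n₀, fun n hn M hM i₁ _ => ?_⟩
  have hMe : (M : ℝ) ≤ e ^ n + 1 := by
    rw [hM, he, ← Real.exp_nat_mul]
    exact (Nat.ceil_lt_add_one (Real.exp_pos _).le).le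
  set μ := (Measure.pi fun _ : Fin M => Measure.pi fun _ : Fin n =>
    gaussianReal 0 P.toNNReal).prod (Measure.pi fun _ : Fin n => gaussianReal 0 N.toNNReal) with hμ
  calc _ ≤ μ ({p | |rhoHat (p.1 i₁) (p.1 i₁ + p.2)| ≤ t} ∪
          ⋃ i ∈ Finset.univ.erase i₁, {p | t ≤ |rhoHat (p.1 i) (p.1 i₁ + p.2)|}) := by
        refine measure_mono fun p ⟨i, hi, hp⟩ => ?_
        rcases le_total |rhoHat (p.1 i₁) (p.1 i₁ + p.2)| t with h | h
        · exact Or.inl h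
        · exact Or.inr (Set.mem_biUnion (Finset.mem_erase.mpr ⟨hi, Finset.mem_univ i⟩)
            (h.trans hp))
    _ ≤ ENNReal.ofReal (d ^ n) + ∑ i ∈ Finset.univ.erase i₁, ENNReal.ofReal (K * q ^ n) := by
        refine (measure_union_le _ _).trans (add_le_add ?_ ?_)
        · rw [hμ, measure_abs_rhoHat_transmitted]
          exact hd n
        · refine (measure_biUnion_finset_le _ _).trans (Finset.sum_le_sum fun i hi => ?_)
          exact measure_le_abs_rhoHat_competitor_le hv _ ht0 hb hbt (Finset.ne_of_mem_erase hi)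
    _ ≤ ENNReal.ofReal (d ^ n) + ∑ i : Fin M, ENNReal.ofReal (K * q ^ n) := by
        gcongr
        exact Finset.subset_univ _
    _ = ENNReal.ofReal (d ^ n + M * (K * q ^ n)) := by
        rw [Finset.sum_const, Finset.card_univ, Fintype.card_fin, nsmul_eq_mul,
          ENNReal.ofReal_add (by positivity) (by positivity),
          ENNReal.ofReal_mul (Nat.cast_nonneg M), ENNReal.ofReal_natCast]
    _ ≤ ENNReal.ofReal ε := by
        refine ENNReal.ofReal_le_ofReal (le_trans ?_ (hn₀ n hn).le)
        have : (e ^ n + 1) * (K * q ^ n) = K * ((e * q) ^ n + q ^ n) := by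
          rw [mul_pow]
          ring
        rw [← this]
        gcongr
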